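/- Let τ have positive imaginary part, q = exp(2πiτ), and θ₁ the first Jacobi theta function. Define a(τ) = 1 + 6∑_{n=1}^{∞} χ₃(n)·qⁿ/(1-qⁿ), where χ₃ is the Legendre symbol modulo 3. Then for all complex z: θ₁(z + π/3|τ)³ + θ₁(z - π/3|τ)³ - θ₁(z|τ)³ = 3·a(τ)·θ₁(3z|3τ), where θ₁(·|3τ) is the theta function with nome q³. -/

import Mathlib

open Complex

/-- The first Jacobi theta function
`θ₁(z|τ) = 2 ∑_{n≥0} (-1)^n q^{(2n+1)²/8} sin((2n+1)z)` with `q = exp(2πiτ)`,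
so that `q^{(2n+1)²/8} = exp(π i τ (2n+1)²/4)`. -/
noncomputable def theta1 (z τ : ℂ) : ℂ :=
  2 * ∑' n : ℕ, (-1 : ℂ) ^ n *
    Complex.exp (Real.pi * Complex.I * τ * (2 * n + 1) ^ 2 / 4) *
    Complex.sin ((2 * n + 1) * z)


/-- The Legendre symbol modulo 3. -/
def chi3 (n : ℕ) : ℤ :=
  if n % 3 = 1 then 1 else if n % 3 = 2 then -1 else 0

/-- The Glaisher–Ramanujan Eisenstein series `a(τ)`, with `q = exp(2πiτ)`. -/
noncomputable def aGR (τ : ℂ) : ℂ :=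
  1 + 6 * ∑' n : ℕ, (chi3 (n + 1) : ℂ) *
    Complex.exp (2 * Real.pi * Complex.I * τ) ^ (n + 1) /
    (1 - Complex.exp (2 * Real.pi * Complex.I * τ) ^ (n + 1))

open Filter Topology

/-- The partial product `∏_{i<n} (1 - q^{i+1})`. -/
noncomputable def qPoch (q : ℂ) (n : ℕ) : ℂ := ∏ i ∈ Finset.range n, (1 - q ^ (i + 1))

/-- The reciprocal of `qPoch q m`, extended by zero to negative `m`. -/
noncomputable def qPochInv (q : ℂ) (m : ℤ) : ℂ := if m < 0 then 0 else (qPoch q m.toNat)⁻¹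

lemma one_sub_pow_succ_ne_zero {q : ℂ} (hq : ‖q‖ < 1) (n : ℕ) : 1 - q ^ (n + 1) ≠ 0 := by
  intro h
  have h1 : ‖q ^ (n + 1)‖ = 1 := by rw [← sub_eq_zero.mp h, norm_one]
  rw [norm_pow] at h1
  exact (pow_lt_one₀ (norm_nonneg _) hq n.succ_ne_zero).ne h1

lemma qPochInv_sub_one {q : ℂ} (hq : ‖q‖ < 1) (m : ℤ) :
    qPochInv q (m - 1) = (1 - q ^ m) * qPochInv q m := by
  rcases lt_trichotomy m 0 with hm | rfl | hm
  · simp [qPochInv, hm, show m - 1 < 0 by omega]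
  · simp [qPochInv]
  · obtain ⟨n, rfl⟩ : ∃ n : ℕ, m = n + 1 := ⟨(m - 1).toNat, by omega⟩
    have h := one_sub_pow_succ_ne_zero hq n
    have h2 : ((n : ℤ) + 1).toNat = n + 1 := by omega
    have h3 : q ^ ((n : ℤ) + 1) = q ^ (n + 1) := by exact_mod_cast zpow_natCast q (n + 1)
    simp only [qPochInv, add_sub_cancel_right, show ¬ ((n : ℤ) < 0) by omega,
      show ¬ ((n : ℤ) + 1 < 0) by omega, if_false, h2, h3, Int.toNat_natCast, qPoch,
      Finset.prod_range_succ]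
    field_simp

/-- The finite form of the Jacobi triple product. -/
lemma hasSum_finite_triple_product {q x : ℂ} (hq0 : q ≠ 0) (hq : ‖q‖ < 1) (hx : x ≠ 0) {g : ℤ → ℂ}
    (hg : ∀ k, g (k + 1) = -x * q ^ k * g k) (N : ℕ) :
    HasSum (fun k : ℤ ↦ g k * (qPoch q (2 * N) * qPochInv q (N + k) * qPochInv q (N - k)))
      (g 0 * ∏ n ∈ Finset.range N, ((1 - x * q ^ n) * (1 - q ^ (n + 1) / x))) := by
  induction N with
  | zero =>
    convert hasSum_ite_eq (0 : ℤ) (g 0) using 2 with k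
    · rcases lt_trichotomy k 0 with hk | rfl | hk
      · simp [qPochInv, hk, hk.ne]
      · simp [qPochInv, qPoch]
      · simp [qPochInv, hk, hk.ne']
    · simp
  | succ N ih =>
    have h1 := (Equiv.subRight (1 : ℤ)).hasSum_iff.mpr ih
    have h2 := (Equiv.addRight (1 : ℤ)).hasSum_iff.mpr ih
    have h := ((ih.mul_left (1 + q ^ (2 * N + 1))).sub (h1.mul_left (x * q ^ N))).sub
      (h2.mul_left (q ^ (N + 1) / x))
    convert h using 1
    · rfl
    · funext k
      simp only [Function.comp_apply, Equiv.subRight_apply, Equiv.coe_addRight]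
      have hg1 : x * q ^ N * g (k - 1) = -q ^ ((N : ℤ) - k + 1) * g k := by
        have := hg (k - 1)
        rw [sub_add_cancel] at this
        rw [this, show (N : ℤ) - k + 1 = N - (k - 1) by ring, zpow_sub₀ hq0, zpow_natCast]
        have := zpow_ne_zero (k - 1) hq0
        field_simp
      have hg2 : q ^ (N + 1) / x * g (k + 1) = -q ^ ((N : ℤ) + k + 1) * g k := by
        rw [hg k, show (N : ℤ) + k + 1 = (N + 1 : ℕ) + k by push_cast; ring, zpow_add₀ hq0,
          zpow_natCast]
        field_simp
      set u := q ^ ((N : ℤ) + k + 1) with hu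
      set v := q ^ ((N : ℤ) - k + 1) with hv
      have huv : q ^ (2 * N + 2) = u * v := by
        rw [hu, hv, ← zpow_add₀ hq0, ← zpow_natCast]
        congr 1; push_cast; ring
      have huv' : q ^ (2 * N + 1) = u * v / q := by
        rw [← huv, eq_div_iff hq0]; ring
      have e1 : qPochInv q (N + k) = (1 - u) * qPochInv q (N + k + 1) := by
        rw [← qPochInv_sub_one hq]; congr 1; ring
      have e2 : qPochInv q (N - k) = (1 - v) * qPochInv q (N - k + 1) := by
        rw [← qPochInv_sub_one hq]; congr 1; ring
      have e3 : qPochInv q (N + (k - 1)) = (1 - u / q) * ((1 - u) * qPochInv q (N + k + 1)) := by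
        rw [← e1, show (N : ℤ) + (k - 1) = N + k - 1 by ring, qPochInv_sub_one hq, hu,
          zpow_add_one₀ hq0, mul_div_cancel_right₀ _ hq0]
      have e4 : qPochInv q (N - (k + 1)) = (1 - v / q) * ((1 - v) * qPochInv q (N - k + 1)) := by
        rw [← e2, show (N : ℤ) - (k + 1) = N - k - 1 by ring, qPochInv_sub_one hq, hv,
          zpow_add_one₀ hq0, mul_div_cancel_right₀ _ hq0]
      rw [← mul_assoc (x * q ^ N), hg1, ← mul_assoc (q ^ (N + 1) / x), hg2, e1, e2, e3, e4,
        show 2 * (N + 1) = 2 * N + 1 + 1 by ring,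
        show (N : ℤ) - (k - 1) = N - k + 1 by ring, show (N : ℤ) + (k + 1) = N + k + 1 by ring,
        show ((N + 1 : ℕ) : ℤ) + k = N + k + 1 by push_cast; ring,
        show ((N + 1 : ℕ) : ℤ) - k = N - k + 1 by push_cast; ring,
        qPoch, Finset.prod_range_succ, Finset.prod_range_succ, ← qPoch, huv', huv]
      field_simp
      ring
    · rw [Finset.prod_range_succ]
      have : q ^ (2 * N + 1) = q ^ N * q ^ N * q := by ring
      rw [this]
      field_simp
      ring

lemma tendsto_qPoch {q : ℂ} (hq : ‖q‖ < 1) :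
    Tendsto (qPoch q) atTop (𝓝 (∏' n : ℕ, (1 - q ^ (n + 1)))) :=
  (ModularForm.multipliable_one_sub_pow hq).hasProd.tendsto_prod_nat

lemma tprod_one_sub_pow_ne_zero {q : ℂ} (hq : ‖q‖ < 1) : ∏' n : ℕ, (1 - q ^ (n + 1)) ≠ 0 := by
  simp_rw [sub_eq_add_neg]
  refine tprod_one_add_ne_zero_of_summable (f := fun n : ℕ ↦ -q ^ (n + 1))
    (fun n ↦ by simpa [sub_eq_add_neg] using one_sub_pow_succ_ne_zero hq n) ?_
  simpa using (summable_nat_add_iff 1).mpr (summable_geometric_of_lt_one (norm_nonneg _) hq)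

lemma tendsto_qPochInv {q : ℂ} (hq : ‖q‖ < 1) :
    Tendsto (qPochInv q) atTop (𝓝 (∏' n : ℕ, (1 - q ^ (n + 1)))⁻¹) := by
  have h := ((tendsto_qPoch hq).inv₀ (tprod_one_sub_pow_ne_zero hq)).comp
    (tendsto_atTop.mpr fun n : ℕ ↦ (eventually_ge_atTop (n : ℤ)).mono fun m hm ↦
      (Int.le_toNat (by omega)).mpr hm)
  refine h.congr' ?_
  filter_upwards [eventually_ge_atTop 0] with m hm
  simp [qPochInv, not_lt.mpr hm]

lemma exists_norm_qPochInv_le {q : ℂ} (hq : ‖q‖ < 1) : ∃ C, ∀ m, ‖qPochInv q m‖ ≤ C := by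
  obtain ⟨C, hC⟩ := (Metric.isBounded_range_of_tendsto _
    ((tendsto_qPoch hq).inv₀ (tprod_one_sub_pow_ne_zero hq))).exists_norm_le
  refine ⟨C, fun m ↦ ?_⟩
  by_cases hm : m < 0
  · simpa [qPochInv, hm] using (norm_nonneg _).trans (hC _ ⟨0, rfl⟩)
  · simpa [qPochInv, hm] using hC _ ⟨m.toNat, rfl⟩

lemma multipliable_one_sub_mul_pow {q : ℂ} (hq : ‖q‖ < 1) (x : ℂ) :
    Multipliable fun n : ℕ ↦ 1 - x * q ^ n := by
  simp_rw [sub_eq_add_neg]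
  refine multipliable_one_add_of_summable ?_
  simpa using (summable_geometric_of_lt_one (norm_nonneg _) hq).mul_left ‖x‖

/-- The Jacobi triple product, for a two-sided sequence given by its recursion. -/
lemma tsum_eq_triple_product {q x : ℂ} (hq0 : q ≠ 0) (hq : ‖q‖ < 1) (hx : x ≠ 0) {g : ℤ → ℂ}
    (hg : ∀ k, g (k + 1) = -x * q ^ k * g k) (hs : Summable g) :
    ∑' k, g k = g 0 * (∏' n : ℕ, (1 - q ^ (n + 1))) * (∏' n : ℕ, (1 - x * q ^ n)) *
      ∏' n : ℕ, (1 - q / x * q ^ n) := by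
  set L := ∏' n : ℕ, (1 - q ^ (n + 1)) with hL
  have hL0 : L ≠ 0 := tprod_one_sub_pow_ne_zero hq
  have hlim : Tendsto (fun N : ℕ ↦ ∑' k : ℤ,
      g k * (qPoch q (2 * N) * qPochInv q (N + k) * qPochInv q (N - k))) atTop
      (𝓝 (∑' k, g k * (L * L⁻¹ * L⁻¹))) := by
    obtain ⟨C, hC⟩ := exists_norm_qPochInv_le hq
    obtain ⟨D, hD⟩ := (Metric.isBounded_range_of_tendsto _ (tendsto_qPoch hq)).exists_norm_le
    refine tendsto_tsum_of_dominated_convergence (bound := fun k ↦ ‖g k‖ * (D * C * C))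
      (hs.norm.mul_right _) (fun k ↦ ?_) (.of_forall fun N k ↦ ?_)
    · refine ((Tendsto.mul (Tendsto.mul ?_ ?_) ?_)).const_mul _
      · exact (tendsto_qPoch hq).comp (tendsto_id.const_mul_atTop' two_pos)
      · exact (tendsto_qPochInv hq).comp
          (tendsto_atTop_add_const_right _ k tendsto_natCast_atTop_atTop)
      · exact (tendsto_qPochInv hq).comp
          (tendsto_atTop_add_const_right _ (-k) tendsto_natCast_atTop_atTop)
    · have hC0 : 0 ≤ C := (norm_nonneg _).trans (hC 0)
      have h1 := hD _ ⟨2 * N, rfl⟩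
      have hD0 : 0 ≤ D := (norm_nonneg _).trans h1
      simp only [norm_mul]
      gcongr
      · exact hC _
      · exact hC _
  have hprod := (((multipliable_one_sub_mul_pow hq x).hasProd.tendsto_prod_nat).mul
    ((multipliable_one_sub_mul_pow hq (q / x)).hasProd.tendsto_prod_nat)).const_mul (g 0)
  have heq := tendsto_nhds_unique hlim (hprod.congr fun N ↦ by
    rw [(hasSum_finite_triple_product hq0 hq hx hg N).tsum_eq, ← Finset.prod_mul_distrib]
    congr 1
    refine Finset.prod_congr rfl fun n _ ↦ ?_
    ring)
  rw [tsum_mul_right, mul_inv_cancel₀ hL0, one_mul] at heq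
  rw [mul_inv_eq_iff_eq_mul₀ hL0] at heq
  rw [heq]
  ring

/-- The general term of the two-sided exponential series of `I * theta1 z τ`. -/
noncomputable def thetaTerm (z τ : ℂ) (n : ℤ) : ℂ :=
  Complex.exp (Real.pi * I * n + Real.pi * I * τ * (2 * n + 1) ^ 2 / 4 + (2 * n + 1) * I * z)

lemma summable_thetaTerm {τ : ℂ} (hτ : 0 < τ.im) (z : ℂ) : Summable (thetaTerm z τ) := by
  have h := ((summable_jacobiTheta₂_term_iff (τ / 2 + z / Real.pi + 1 / 2) τ).mpr hτ).mul_left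
    (Complex.exp (Real.pi * I * τ / 4 + I * z))
  refine h.congr fun n ↦ ?_
  have hpi : (Real.pi : ℂ) ≠ 0 := by exact_mod_cast Real.pi_ne_zero
  rw [thetaTerm, jacobiTheta₂_term, ← Complex.exp_add]
  congr 1
  field_simp
  ring

lemma exp_pi_mul_I_mul_int (n : ℤ) : Complex.exp (Real.pi * I * n) = (-1) ^ n := by
  rw [mul_comm, Complex.exp_int_mul, Complex.exp_pi_mul_I]

lemma tsum_thetaTerm {τ : ℂ} (hτ : 0 < τ.im) (z : ℂ) : ∑' n, thetaTerm z τ n = I * theta1 z τ := by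
  have hs := summable_thetaTerm hτ z
  have h1 : Summable fun n : ℕ ↦ thetaTerm z τ n :=
    hs.comp_injective Nat.cast_injective
  have h2 : Summable fun n : ℕ ↦ thetaTerm z τ (-(n + 1)) :=
    hs.comp_injective (i := fun n : ℕ ↦ (-((n : ℤ) + 1))) fun a b h ↦ by simpa using h
  rw [tsum_of_nat_of_neg_add_one h1 h2, ← h1.tsum_add h2, theta1, ← mul_assoc, ← tsum_mul_left]
  refine tsum_congr fun n ↦ ?_
  simp only [thetaTerm, Complex.exp_add, exp_pi_mul_I_mul_int, Complex.sin]
  have e1 : ((-1 : ℂ)) ^ (-((n : ℤ) + 1)) = -(-1) ^ n := by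
    rw [zpow_neg, ← inv_zpow, inv_neg_one]
    exact_mod_cast pow_succ' (-1 : ℂ) n |>.trans (neg_one_mul _)
  rw [e1, zpow_natCast]
  push_cast
  have e2 : (2 * (-((n : ℂ) + 1)) + 1) = -(2 * n + 1) := by ring
  rw [e2, neg_sq, show -(2 * (n : ℂ) + 1) * I * z = -((2 * n + 1) * z) * I by ring,
    show (2 * (n : ℂ) + 1) * I * z = ((2 * n + 1) * z) * I by ring]
  linear_combination (-((-1) ^ n *
    Complex.exp (Real.pi * I * τ * (2 * n + 1) ^ 2 / 4) *
    (Complex.exp (-((2 * n + 1) * z) * I) - Complex.exp ((2 * n + 1) * z * I)))) * I_sq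

/-- The cubic theta series `∑ q ^ (a² + ab + b²)` over `ℤ²`, with `q = exp(2πiτ)`. -/
noncomputable def cubicThetaA (τ : ℂ) : ℂ :=
  ∑' p : ℤ × ℤ, Complex.exp (2 * Real.pi * I * τ * (p.1 ^ 2 + p.1 * p.2 + p.2 ^ 2))

lemma theta1_cube {τ : ℂ} (hτ : 0 < τ.im) (z : ℂ) :
    HasSum (fun p : (ℤ × ℤ) × ℤ ↦ thetaTerm z τ p.1.1 * thetaTerm z τ p.1.2 * thetaTerm z τ p.2)
      (-I * theta1 z τ ^ 3) := by
  have hs := (summable_thetaTerm hτ z).norm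
  have h2 := hs.mul_norm hs
  have h3 := h2.mul_norm hs
  have h := h3.of_norm.hasSum
  convert h using 1
  · rfl
  rw [← tsum_mul_tsum_of_summable_norm h2 hs, ← tsum_mul_tsum_of_summable_norm hs hs,
    tsum_thetaTerm hτ]
  linear_combination (-I * theta1 z τ ^ 3) * I_sq

lemma thetaTerm_add (z w τ : ℂ) (n : ℤ) :
    thetaTerm (z + w) τ n = thetaTerm z τ n * Complex.exp ((2 * n + 1) * I * w) := by
  rw [thetaTerm, thetaTerm, ← Complex.exp_add]
  congr 1
  ring

lemma cos_pi_div_three_complex : Complex.cos (Real.pi / 3) = 1 / 2 := by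
  rw [show (Real.pi : ℂ) / 3 = ((Real.pi / 3 : ℝ) : ℂ) by push_cast; rfl,
    ← Complex.ofReal_cos, Real.cos_pi_div_three]
  norm_num

lemma exp_cube_weight (s : ℤ) :
    Complex.exp ((2 * s + 3) * I * (Real.pi / 3)) + Complex.exp (-((2 * s + 3) * I * (Real.pi / 3)))
      - 1 = if (3 : ℤ) ∣ s then -3 else 0 := by
  have h : Complex.exp ((2 * s + 3) * I * (Real.pi / 3)) +
      Complex.exp (-((2 * s + 3) * I * (Real.pi / 3))) =
      -(2 * Complex.cos (2 * Real.pi * s / 3)) := by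
    rw [show (2 * (s : ℂ) + 3) * I * (Real.pi / 3) = 2 * Real.pi * s / 3 * I + Real.pi * I by ring,
      neg_add, Complex.exp_add, Complex.exp_add, Complex.exp_neg (Real.pi * I),
      Complex.exp_pi_mul_I, Complex.two_cos]
    rw [neg_mul]
    ring
  rw [h]
  obtain ⟨k, hk | hk | hk⟩ : ∃ k : ℤ, s = 3 * k ∨ s = 3 * k + 1 ∨ s = 3 * k - 1 :=
    ⟨(s + 1) / 3, by omega⟩
  · rw [if_pos ⟨k, hk⟩, hk, show 2 * (Real.pi : ℂ) * ((3 * k : ℤ) : ℂ) / 3 = k * (2 * Real.pi) by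
      push_cast; ring, Complex.cos_int_mul_two_pi]
    norm_num
  all_goals
    have hc : Complex.cos (2 * (Real.pi : ℂ) * s / 3) = -1 / 2 := by
      rw [hk]
      push_cast
      first
      | rw [show 2 * (Real.pi : ℂ) * (3 * k + 1) / 3 = Real.pi - Real.pi / 3 + k * (2 * Real.pi) by
          ring, Complex.cos_add_int_mul_two_pi, Complex.cos_pi_sub, cos_pi_div_three_complex]
        norm_num
      | rw [show 2 * (Real.pi : ℂ) * (3 * k - 1) / 3 = Real.pi / 3 - Real.pi + k * (2 * Real.pi) by
          ring, Complex.cos_add_int_mul_two_pi, Complex.cos_sub_pi, cos_pi_div_three_complex]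
        norm_num
    rw [hc, if_neg (by omega)]
    norm_num

lemma theta_cube_eq_cubicThetaA {τ : ℂ} (hτ : 0 < τ.im) (z : ℂ) :
    theta1 (z + Real.pi / 3) τ ^ 3 + theta1 (z - Real.pi / 3) τ ^ 3 - theta1 z τ ^ 3 =
      3 * cubicThetaA τ * theta1 (3 * z) (3 * τ) := by
  have hτ3 : 0 < (3 * τ).im := by simpa using hτ
  let e : ℤ × (ℤ × ℤ) → (ℤ × ℤ) × ℤ :=
    fun p ↦ ((p.1 + p.2.1, p.1 + p.2.2), p.1 - p.2.1 - p.2.2)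
  have he : Function.Injective e := by
    rintro ⟨k, a, b⟩ ⟨k', a', b'⟩ h
    simp only [e, Prod.mk.injEq] at h ⊢
    omega
  have h := ((theta1_cube hτ (z + Real.pi / 3)).add (theta1_cube hτ (z + -(Real.pi / 3)))).sub
    (theta1_cube hτ z)
  have hF : ∀ p : (ℤ × ℤ) × ℤ,
      thetaTerm (z + Real.pi / 3) τ p.1.1 * thetaTerm (z + Real.pi / 3) τ p.1.2 *
          thetaTerm (z + Real.pi / 3) τ p.2 +
        thetaTerm (z + -(Real.pi / 3)) τ p.1.1 * thetaTerm (z + -(Real.pi / 3)) τ p.1.2 *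
          thetaTerm (z + -(Real.pi / 3)) τ p.2 -
        thetaTerm z τ p.1.1 * thetaTerm z τ p.1.2 * thetaTerm z τ p.2 =
      thetaTerm z τ p.1.1 * thetaTerm z τ p.1.2 * thetaTerm z τ p.2 *
        if (3 : ℤ) ∣ p.1.1 + p.1.2 + p.2 then -3 else 0 := by
    rintro ⟨⟨a, b⟩, c⟩
    have hw : ∀ w : ℂ, Complex.exp ((2 * a + 1) * I * w) * Complex.exp ((2 * b + 1) * I * w) *
        Complex.exp ((2 * c + 1) * I * w) =
        Complex.exp ((2 * ((a + b + c : ℤ) : ℂ) + 3) * I * w) := fun w ↦ by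
      rw [← Complex.exp_add, ← Complex.exp_add]
      congr 1
      push_cast
      ring
    have h1 := hw (Real.pi / 3)
    have h2 := hw (-(Real.pi / 3))
    rw [mul_neg ((2 * ((a + b + c : ℤ) : ℂ) + 3) * I)] at h2
    simp only [thetaTerm_add]
    rw [← exp_cube_weight, ← h1, ← h2]
    ring
  simp only [hF] at h
  rw [← he.hasSum_iff] at h
  · have hprod : ∀ p : ℤ × (ℤ × ℤ), thetaTerm z τ (e p).1.1 * thetaTerm z τ (e p).1.2 *
        thetaTerm z τ (e p).2 * (if (3 : ℤ) ∣ (e p).1.1 + (e p).1.2 + (e p).2 then -3 else 0) =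
        thetaTerm (3 * z) (3 * τ) p.1 * (-3 * Complex.exp (2 * Real.pi * I * τ *
          (p.2.1 ^ 2 + p.2.1 * p.2.2 + p.2.2 ^ 2))) := by
      rintro ⟨k, a, b⟩
      have hd : (3 : ℤ) ∣ (k + a) + (k + b) + (k - a - b) := ⟨k, by ring⟩
      simp only [e, if_pos hd]
      have hx : Complex.exp (2 * Real.pi * I * k) = 1 := by
        rw [mul_comm]; exact Complex.exp_int_mul_two_pi_mul_I k
      suffices thetaTerm z τ (k + a) * thetaTerm z τ (k + b) * thetaTerm z τ (k - a - b) =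
          thetaTerm (3 * z) (3 * τ) k * Complex.exp (2 * Real.pi * I * τ *
            (a ^ 2 + a * b + b ^ 2)) * Complex.exp (2 * Real.pi * I * k) by
        rw [this, hx]; ring
      simp only [thetaTerm, ← Complex.exp_add]
      congr 1
      push_cast
      ring
    have h' : HasSum (fun p : ℤ × (ℤ × ℤ) ↦ thetaTerm (3 * z) (3 * τ) p.1 *
        (-3 * Complex.exp (2 * Real.pi * I * τ *
          (p.2.1 ^ 2 + p.2.1 * p.2.2 + p.2.2 ^ 2)))) _ :=
      h.congr_fun fun p ↦ (hprod p).symm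
    have ht := h'.tsum_eq
    rw [h'.summable.tsum_prod] at ht
    simp only [tsum_mul_left, tsum_mul_right] at ht
    rw [tsum_thetaTerm hτ3, ← cubicThetaA, ← sub_eq_add_neg] at ht
    have := congrArg (I * ·) ht
    linear_combination (theta1 (z + Real.pi / 3) τ ^ 3 + theta1 (z - Real.pi / 3) τ ^ 3 -
      theta1 z τ ^ 3 - 3 * cubicThetaA τ * theta1 (3 * z) (3 * τ)) * I_sq - this
  · rintro ⟨⟨a, b⟩, c⟩ hp
    rw [if_neg, mul_zero]
    rintro ⟨k, hk⟩
    refine hp ⟨(k, a - k, b - k), ?_⟩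
    simp only [e, Prod.mk.injEq] at hk ⊢
    omega

/-- The factor `∏ (1 - 2 q^{n+1} cos 2z + q^{2n+2})` of the theta product. -/
noncomputable def thetaProd (q z : ℂ) : ℂ :=
  ∏' n : ℕ, (1 + q ^ (n + 1) * (q ^ (n + 1) - 2 * Complex.cos (2 * z)))

lemma norm_exp_two_pi_I_mul_lt_one {τ : ℂ} (hτ : 0 < τ.im) :
    ‖Complex.exp (2 * Real.pi * I * τ)‖ < 1 := by
  simpa using UpperHalfPlane.norm_exp_two_pi_I_lt_one ⟨τ, hτ⟩

lemma multipliable_one_sub_mul_pow_succ {q : ℂ} (hq : ‖q‖ < 1) (x : ℂ) :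
    Multipliable fun n : ℕ ↦ 1 - x * q ^ (n + 1) := by
  refine (multipliable_one_sub_mul_pow hq (x * q)).congr fun n ↦ ?_
  rw [pow_succ', mul_assoc]

lemma tprod_mul_tprod_eq_thetaProd {q : ℂ} (hq : ‖q‖ < 1) {w z : ℂ} (hw0 : w ≠ 0)
    (hc : 2 * Complex.cos (2 * z) = w ^ 2 + (w ^ 2)⁻¹) :
    (∏' n : ℕ, (1 - q * w ^ 2 * q ^ n)) * (∏' n : ℕ, (1 - (w ^ 2)⁻¹ * q ^ (n + 1))) =
      thetaProd q z := by
  rw [← (multipliable_one_sub_mul_pow hq (q * w ^ 2)).tprod_mul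
    (multipliable_one_sub_mul_pow_succ hq (w ^ 2)⁻¹)]
  refine tprod_congr fun n ↦ ?_
  have hw2 : w ^ 2 * (w ^ 2)⁻¹ = 1 := mul_inv_cancel₀ (pow_ne_zero 2 hw0)
  rw [hc]
  linear_combination q ^ (n + 1) * q ^ (n + 1) * hw2

lemma triple_product_eq_thetaProd {q : ℂ} (hq : ‖q‖ < 1) {w z : ℂ} (hw0 : w ≠ 0)
    (hc : 2 * Complex.cos (2 * z) = w ^ 2 + (w ^ 2)⁻¹) :
    (∏' n : ℕ, (1 - q * w ^ 2 * q ^ n)) * (∏' n : ℕ, (1 - (w ^ 2)⁻¹ * q ^ n)) =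
      (1 - (w ^ 2)⁻¹) * thetaProd q z := by
  have h0 : ∏' n : ℕ, (1 - (w ^ 2)⁻¹ * q ^ n) =
      (1 - (w ^ 2)⁻¹ * q ^ 0) * ∏' n : ℕ, (1 - (w ^ 2)⁻¹ * q ^ (n + 1)) :=
    tprod_eq_zero_mul' (f := fun n : ℕ ↦ 1 - (w ^ 2)⁻¹ * q ^ n)
      (multipliable_one_sub_mul_pow_succ hq _)
  have h1 := tprod_mul_tprod_eq_thetaProd hq hw0 hc
  generalize (∏' n : ℕ, (1 - q * w ^ 2 * q ^ n)) = P at *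
  generalize (∏' n : ℕ, (1 - (w ^ 2)⁻¹ * q ^ (n + 1))) = R at *
  linear_combination P * h0 + (1 - (w ^ 2)⁻¹) * h1

lemma thetaTerm_add_one (z τ : ℂ) (k : ℤ) :
    thetaTerm z τ (k + 1) = -(Complex.exp (2 * Real.pi * I * τ) * Complex.exp (z * I) ^ 2) *
      Complex.exp (2 * Real.pi * I * τ) ^ k * thetaTerm z τ k := by
  rw [← Complex.exp_int_mul, ← Complex.exp_nat_mul, neg_mul, neg_mul, ← neg_one_mul,
    ← Complex.exp_pi_mul_I, thetaTerm, thetaTerm, ← Complex.exp_add, ← Complex.exp_add,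
    ← Complex.exp_add, ← Complex.exp_add]
  congr 1
  push_cast
  ring

lemma theta1_eq_thetaProd {τ : ℂ} (hτ : 0 < τ.im) (z : ℂ) :
    theta1 z τ = 2 * Complex.exp (Real.pi * I * τ / 4) *
      (∏' n : ℕ, (1 - Complex.exp (2 * Real.pi * I * τ) ^ (n + 1))) *
      (Complex.sin z * thetaProd (Complex.exp (2 * Real.pi * I * τ)) z) := by
  have hq := norm_exp_two_pi_I_mul_lt_one hτ
  have hq0 : Complex.exp (2 * Real.pi * I * τ) ≠ 0 := Complex.exp_ne_zero _
  have hw0 : Complex.exp (z * I) ≠ 0 := Complex.exp_ne_zero _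
  have hg := thetaTerm_add_one z τ
  have hg0 : thetaTerm z τ 0 = Complex.exp (Real.pi * I * τ / 4) * Complex.exp (z * I) := by
    rw [thetaTerm, ← Complex.exp_add]
    congr 1
    push_cast
    ring
  have hc : 2 * Complex.cos (2 * z) =
      Complex.exp (z * I) ^ 2 + (Complex.exp (z * I) ^ 2)⁻¹ := by
    rw [Complex.two_cos, ← Complex.exp_nat_mul, ← Complex.exp_neg]
    congr 2 <;> push_cast <;> ring
  have hs : 2 * Complex.sin z = ((Complex.exp (z * I))⁻¹ - Complex.exp (z * I)) * I := by
    rw [Complex.two_sin, ← Complex.exp_neg, neg_mul]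
  generalize Complex.exp (2 * Real.pi * I * τ) = q at *
  generalize Complex.exp (z * I) = w at *
  have h := tsum_eq_triple_product hq0 hq (mul_ne_zero hq0 (pow_ne_zero 2 hw0)) hg
    (summable_thetaTerm hτ z)
  have hx : q / (q * w ^ 2) = (w ^ 2)⁻¹ := by field_simp
  have hwi : w * (1 - (w ^ 2)⁻¹) = w - w⁻¹ := by field_simp
  rw [tsum_thetaTerm hτ, hx, mul_assoc, triple_product_eq_thetaProd hq hw0 hc, hg0] at h
  generalize thetaProd q z = P at *
  generalize (∏' n : ℕ, (1 - q ^ (n + 1))) = E at *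
  generalize Complex.exp (Real.pi * I * τ / 4) = e at *
  linear_combination (-I) * h - e * E * P * hs - I * e * E * P * hwi + theta1 z τ * I_sq

lemma norm_pow_mul_pow_sub_le {q : ℂ} (hq : ‖q‖ < 1) (c : ℂ) (n : ℕ) :
    ‖q ^ (n + 1) * (q ^ (n + 1) - c)‖ ≤ ‖q‖ ^ (n + 1) * (1 + ‖c‖) := by
  rw [norm_mul, norm_pow]
  gcongr
  refine (norm_sub_le _ _).trans (add_le_add_left ?_ _)
  rw [norm_pow]
  exact pow_le_one₀ (norm_nonneg _) hq.le

lemma summable_norm_pow_succ_mul {q : ℂ} (hq : ‖q‖ < 1) (C : ℝ) :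
    Summable fun n : ℕ ↦ ‖q‖ ^ (n + 1) * (1 + C) :=
  ((summable_nat_add_iff 1).mpr (summable_geometric_of_lt_one (norm_nonneg _) hq)).mul_right _

lemma multipliableLocallyUniformlyOn_thetaProd {q : ℂ} (hq : ‖q‖ < 1) :
    MultipliableLocallyUniformlyOn
      (fun (n : ℕ) (z : ℂ) ↦ 1 + q ^ (n + 1) * (q ^ (n + 1) - 2 * Complex.cos (2 * z)))
      Set.univ := by
  refine ⟨fun z ↦ thetaProd q z, hasProdLocallyUniformlyOn_of_forall_compact isOpen_univ
    fun K _ hK ↦ ?_⟩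
  obtain ⟨C, hC⟩ := hK.exists_bound_of_continuousOn
    (f := fun z : ℂ ↦ 2 * Complex.cos (2 * z)) (by fun_prop)
  refine (summable_norm_pow_succ_mul hq C).hasProdUniformlyOn_nat_one_add hK
    (.of_forall fun n z hz ↦ (norm_pow_mul_pow_sub_le hq _ n).trans ?_) (fun _ ↦ by fun_prop)
  gcongr
  exact hC z hz

lemma differentiable_thetaProd {q : ℂ} (hq : ‖q‖ < 1) : Differentiable ℂ (thetaProd q) := by
  rw [← differentiableOn_univ]
  exact (multipliableLocallyUniformlyOn_thetaProd hq).hasProdLocallyUniformlyOn.differentiableOn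
    (.of_forall fun _ ↦ by simpa [Finset.prod_fn] using
      DifferentiableOn.finsetProd (fun _ _ ↦ by fun_prop)) isOpen_univ

lemma norm_chi3_le (n : ℕ) : ‖(chi3 n : ℂ)‖ ≤ 1 := by
  unfold chi3
  split_ifs <;> simp

lemma one_add_add_sq_ne_zero {x : ℂ} (hx : ‖x‖ < 1) : 1 + x + x ^ 2 ≠ 0 := by
  intro h
  refine one_sub_pow_succ_ne_zero hx 2 ?_
  linear_combination (1 - x) * h

lemma tsum_chi3_mul_pow {x : ℂ} (hx : ‖x‖ < 1) :
    ∑' m : ℕ, (chi3 (m + 1) : ℂ) * x ^ (m + 1) = x / (1 + x + x ^ 2) := by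
  have hs : Summable fun m : ℕ ↦ (chi3 (m + 1) : ℂ) * x ^ (m + 1) := by
    refine .of_norm_bounded ((summable_nat_add_iff 1).mpr
      (summable_geometric_of_lt_one (norm_nonneg _) hx)) fun m ↦ ?_
    rw [norm_mul, norm_pow]
    exact mul_le_of_le_one_left (by positivity) (norm_chi3_le _)
  have hs1 := (summable_nat_add_iff 1).mpr hs
  have hs2 := (summable_nat_add_iff 2).mpr hs
  have h1 := hs.sum_add_tsum_nat_add 1
  have h2 := hs.sum_add_tsum_nat_add 2
  have h0 : (∑' m : ℕ, (chi3 (m + 2 + 1) : ℂ) * x ^ (m + 2 + 1)) +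
      x * (∑' m : ℕ, (chi3 (m + 1 + 1) : ℂ) * x ^ (m + 1 + 1)) +
      x ^ 2 * (∑' m : ℕ, (chi3 (m + 1) : ℂ) * x ^ (m + 1)) = 0 := by
    rw [← tsum_mul_left, ← tsum_mul_left, ← hs2.tsum_add (hs1.mul_left x),
      ← (hs2.add (hs1.mul_left x)).tsum_add (hs.mul_left (x ^ 2))]
    convert tsum_zero using 3 with m
    have hc : (chi3 (m + 2 + 1) : ℂ) + chi3 (m + 1 + 1) + chi3 (m + 1) = 0 := by
      have : chi3 (m + 2 + 1) + chi3 (m + 1 + 1) + chi3 (m + 1) = 0 := by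
        unfold chi3
        split_ifs <;> omega
      exact_mod_cast this
    linear_combination x ^ (m + 3) * hc
  have c1 : chi3 1 = 1 := rfl
  have c2 : chi3 2 = -1 := rfl
  simp only [Finset.sum_range_succ, Finset.sum_range_zero, zero_add, Nat.reduceAdd, c1, c2] at h1 h2
  push_cast at h1 h2
  rw [eq_div_iff (one_add_add_sq_ne_zero hx)]
  linear_combination h0 - h2 - x * h1

lemma summable_chi3_mul_pow_mul {q : ℂ} (hq : ‖q‖ < 1) :
    Summable fun p : ℕ × ℕ ↦ (chi3 (p.2 + 1) : ℂ) * (q ^ (p.1 + 1)) ^ (p.2 + 1) := by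
  have hs := summable_geometric_of_lt_one (norm_nonneg _) hq
  refine .of_norm_bounded (hs.mul_of_nonneg hs (fun _ ↦ by positivity) (fun _ ↦ by positivity))
    fun p ↦ ?_
  rw [norm_mul, norm_pow, norm_pow, ← pow_mul, ← pow_add]
  refine (mul_le_of_le_one_left (by positivity) (norm_chi3_le _)).trans ?_
  exact pow_le_pow_of_le_one (norm_nonneg _) hq.le (by nlinarith)

lemma norm_pow_succ_lt_one {q : ℂ} (hq : ‖q‖ < 1) (n : ℕ) : ‖q ^ (n + 1)‖ < 1 := by
  rw [norm_pow]
  exact pow_lt_one₀ (norm_nonneg _) hq n.succ_ne_zero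

/-- The Lambert series rearrangement for the character modulo 3. -/
lemma hasSum_lambert_chi3 {q : ℂ} (hq : ‖q‖ < 1) :
    HasSum (fun n : ℕ ↦ q ^ (n + 1) / (1 + q ^ (n + 1) + (q ^ (n + 1)) ^ 2))
      (∑' n : ℕ, (chi3 (n + 1) : ℂ) * q ^ (n + 1) / (1 - q ^ (n + 1))) := by
  have hs := summable_chi3_mul_pow_mul hq
  have h1 := hs.prod
  simp only [tsum_chi3_mul_pow (norm_pow_succ_lt_one hq _)] at h1
  have h2 := hs.tsum_comm (f := fun n m ↦ (chi3 (m + 1) : ℂ) * (q ^ (n + 1)) ^ (m + 1))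
  simp only [tsum_chi3_mul_pow (norm_pow_succ_lt_one hq _)] at h2
  rw [h1.hasSum_iff]
  rw [← h2]
  refine tsum_congr fun m ↦ ?_
  rw [tsum_mul_left, mul_div_assoc]
  congr 1
  have h3 : ∀ n : ℕ, (q ^ (n + 1)) ^ (m + 1) = q ^ (m + 1) * (q ^ (m + 1)) ^ n := fun n ↦ by ring
  simp only [h3]
  rw [tsum_mul_left, tsum_geometric_of_norm_lt_one (norm_pow_succ_lt_one hq m), div_eq_mul_inv]

lemma cos_two_pi_div_three_complex : Complex.cos (2 * (Real.pi / 3)) = -1 / 2 := by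
  rw [Complex.cos_two_mul, cos_pi_div_three_complex]
  norm_num

lemma logDeriv_thetaProd_pi_div_three {q : ℂ} (hq : ‖q‖ < 1) :
    logDeriv (thetaProd q) (Real.pi / 3) = 4 * Complex.sin (2 * (Real.pi / 3)) *
      ∑' n : ℕ, (chi3 (n + 1) : ℂ) * q ^ (n + 1) / (1 - q ^ (n + 1)) := by
  have hval (n : ℕ) : 1 + q ^ (n + 1) * (q ^ (n + 1) - 2 * Complex.cos (2 * (Real.pi / 3))) =
      1 + q ^ (n + 1) + (q ^ (n + 1)) ^ 2 := by
    rw [cos_two_pi_div_three_complex]; ring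
  have hne (n : ℕ) : 1 + q ^ (n + 1) + (q ^ (n + 1)) ^ 2 ≠ 0 :=
    one_add_add_sq_ne_zero (norm_pow_succ_lt_one hq n)
  have hlog (n : ℕ) : logDeriv
      (fun z : ℂ ↦ 1 + q ^ (n + 1) * (q ^ (n + 1) - 2 * Complex.cos (2 * z))) (Real.pi / 3) =
      4 * Complex.sin (2 * (Real.pi / 3)) *
        (q ^ (n + 1) / (1 + q ^ (n + 1) + (q ^ (n + 1)) ^ 2)) := by
    have hd : HasDerivAt
        (fun z : ℂ ↦ 1 + q ^ (n + 1) * (q ^ (n + 1) - 2 * Complex.cos (2 * z)))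
        (q ^ (n + 1) * (-(2 * (-Complex.sin (2 * (Real.pi / 3)) * (2 * 1)))))
        ((Real.pi : ℂ) / 3) :=
      ((((((hasDerivAt_id ((Real.pi : ℂ) / 3)).const_mul 2).ccos).const_mul 2).const_sub
        _).const_mul _).const_add _
    rw [logDeriv_apply, hd.deriv, hval]
    ring
  have hsum := (hasSum_lambert_chi3 hq).mul_left (4 * Complex.sin (2 * (Real.pi / 3)))
  have h := logDeriv_tprod_eq_tsum isOpen_univ (Set.mem_univ ((Real.pi : ℂ) / 3))
    (f := fun (n : ℕ) (z : ℂ) ↦ 1 + q ^ (n + 1) * (q ^ (n + 1) - 2 * Complex.cos (2 * z)))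
    (fun n ↦ by rw [hval]; exact hne n) (fun n ↦ by fun_prop)
    (by simpa only [hlog] using hsum.summable) (multipliableLocallyUniformlyOn_thetaProd hq) ?_
  · simp only [hlog] at h
    rw [hsum.tsum_eq] at h
    exact h
  · refine tprod_one_add_ne_zero_of_summable (fun n ↦ by rw [hval]; exact hne n) ?_
    exact .of_nonneg_of_le (fun _ ↦ norm_nonneg _) (norm_pow_mul_pow_sub_le hq _)
      (summable_norm_pow_succ_mul hq _)

lemma tprod_mul_thetaProd_pi_div_three {q : ℂ} (hq : ‖q‖ < 1) :
    (∏' n : ℕ, (1 - q ^ (n + 1))) * thetaProd q (Real.pi / 3) =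
      ∏' n : ℕ, (1 - (q ^ 3) ^ (n + 1)) := by
  rw [thetaProd, ← (ModularForm.multipliable_one_sub_pow hq).tprod_mul
    ((multipliableLocallyUniformlyOn_thetaProd hq).multipliable (Set.mem_univ _))]
  refine tprod_congr fun n ↦ ?_
  rw [cos_two_pi_div_three_complex]
  ring

lemma thetaProd_zero {q : ℂ} (hq : ‖q‖ < 1) :
    thetaProd q 0 = (∏' n : ℕ, (1 - q ^ (n + 1))) ^ 2 := by
  rw [thetaProd, ← (ModularForm.multipliable_one_sub_pow hq).tprod_pow]
  refine tprod_congr fun n ↦ ?_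
  simp only [mul_zero, Complex.cos_zero]
  ring


lemma theta1_neg (z τ : ℂ) : theta1 (-z) τ = -theta1 z τ := by
  simp only [theta1, mul_neg, Complex.sin_neg, tsum_neg]

lemma hasDerivAt_theta1 {τ : ℂ} (hτ : 0 < τ.im) (z : ℂ) :
    HasDerivAt (fun w ↦ theta1 w τ) (2 * Complex.exp (Real.pi * I * τ / 4) *
      (∏' n : ℕ, (1 - Complex.exp (2 * Real.pi * I * τ) ^ (n + 1))) *
      (Complex.cos z * thetaProd (Complex.exp (2 * Real.pi * I * τ)) z +
        Complex.sin z * deriv (thetaProd (Complex.exp (2 * Real.pi * I * τ))) z)) z := by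
  simp only [theta1_eq_thetaProd hτ]
  exact ((Complex.hasDerivAt_sin z).mul (differentiable_thetaProd
    (norm_exp_two_pi_I_mul_lt_one hτ) z).hasDerivAt).const_mul _

lemma theta1_zero (τ : ℂ) : theta1 0 τ = 0 := by
  simp [theta1]

lemma exp_two_pi_I_mul_three (τ : ℂ) :
    Complex.exp (2 * Real.pi * I * (3 * τ)) = Complex.exp (2 * Real.pi * I * τ) ^ 3 := by
  rw [← Complex.exp_nat_mul]
  congr 1
  push_cast
  ring

lemma hasDerivAt_theta1_three_mul {τ : ℂ} (hτ : 0 < τ.im) :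
    HasDerivAt (fun w ↦ theta1 (3 * w) (3 * τ)) (3 * (2 * Complex.exp (Real.pi * I * τ / 4) ^ 3 *
      (∏' n : ℕ, (1 - (Complex.exp (2 * Real.pi * I * τ) ^ 3) ^ (n + 1))) ^ 3)) 0 := by
  have hτ3 : 0 < (3 * τ).im := by simpa using hτ
  have he : Complex.exp (Real.pi * I * (3 * τ) / 4) = Complex.exp (Real.pi * I * τ / 4) ^ 3 := by
    rw [← Complex.exp_nat_mul]
    congr 1
    push_cast
    ring
  have h := hasDerivAt_theta1 hτ3 (3 * 0)
  rw [mul_zero, thetaProd_zero (norm_exp_two_pi_I_mul_lt_one hτ3), exp_two_pi_I_mul_three, he,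
    Complex.cos_zero, Complex.sin_zero, ← mul_zero (3 : ℂ)] at h
  refine (h.comp (0 : ℂ) ((hasDerivAt_id (0 : ℂ)).const_mul 3)).congr_deriv ?_
  generalize (∏' n : ℕ, (1 - (Complex.exp (2 * Real.pi * I * τ) ^ 3) ^ (n + 1))) = E
  ring

lemma hasDerivAt_theta1_pi_div_three {τ : ℂ} (hτ : 0 < τ.im) :
    HasDerivAt (fun w ↦ theta1 w τ) (Complex.exp (Real.pi * I * τ / 4) *
      (∏' n : ℕ, (1 - (Complex.exp (2 * Real.pi * I * τ) ^ 3) ^ (n + 1))) * aGR τ)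
      (Real.pi / 3) := by
  have hq := norm_exp_two_pi_I_mul_lt_one hτ
  have hlog := logDeriv_thetaProd_pi_div_three hq
  have hEQ := tprod_mul_thetaProd_pi_div_three hq
  have hE₃ := tprod_one_sub_pow_ne_zero (q := Complex.exp (2 * Real.pi * I * τ) ^ 3)
    (norm_pow_succ_lt_one hq 2)
  have hs := Complex.sin_sq_add_cos_sq (Real.pi / 3)
  rw [Complex.sin_two_mul] at hlog
  refine (hasDerivAt_theta1 hτ (Real.pi / 3)).congr_deriv ?_
  rw [aGR]
  rw [cos_pi_div_three_complex] at hlog hs ⊢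
  rw [← hEQ] at hE₃ ⊢
  rw [logDeriv_apply, div_eq_iff (right_ne_zero_of_mul hE₃)] at hlog
  rw [hlog]
  generalize (∏' n : ℕ, (1 - Complex.exp (2 * Real.pi * I * τ) ^ (n + 1))) = E
  linear_combination 8 * Complex.exp (Real.pi * I * τ / 4) * E *
    thetaProd (Complex.exp (2 * Real.pi * I * τ)) (Real.pi / 3) *
    (∑' n : ℕ, (chi3 (n + 1) : ℂ) * Complex.exp (2 * Real.pi * I * τ) ^ (n + 1) /
      (1 - Complex.exp (2 * Real.pi * I * τ) ^ (n + 1))) * hs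

lemma theta1_pi_div_three_sq {τ : ℂ} (hτ : 0 < τ.im) :
    theta1 (Real.pi / 3) τ ^ 2 = 3 * Complex.exp (Real.pi * I * τ / 4) ^ 2 *
      (∏' n : ℕ, (1 - (Complex.exp (2 * Real.pi * I * τ) ^ 3) ^ (n + 1))) ^ 2 := by
  have hs := Complex.sin_sq_add_cos_sq (Real.pi / 3)
  rw [cos_pi_div_three_complex] at hs
  rw [theta1_eq_thetaProd hτ, ← tprod_mul_thetaProd_pi_div_three (norm_exp_two_pi_I_mul_lt_one hτ)]
  generalize (∏' n : ℕ, (1 - Complex.exp (2 * Real.pi * I * τ) ^ (n + 1))) = E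
  linear_combination 4 * Complex.exp (Real.pi * I * τ / 4) ^ 2 * E ^ 2 *
    thetaProd (Complex.exp (2 * Real.pi * I * τ)) (Real.pi / 3) ^ 2 * hs

lemma hasDerivAt_theta_cube_zero {τ d : ℂ} (hτ : 0 < τ.im)
    (hd : HasDerivAt (fun w ↦ theta1 w τ) d (Real.pi / 3)) :
    HasDerivAt (fun z ↦ theta1 (z + Real.pi / 3) τ ^ 3 + theta1 (z - Real.pi / 3) τ ^ 3 -
      theta1 z τ ^ 3) (6 * theta1 (Real.pi / 3) τ ^ 2 * d) 0 := by
  have hadd : HasDerivAt (fun z : ℂ ↦ theta1 (z + Real.pi / 3) τ) d 0 :=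
    .comp_add_const 0 (Real.pi / 3 : ℂ) (by rwa [zero_add])
  have hsub : HasDerivAt (fun z : ℂ ↦ theta1 (z - Real.pi / 3) τ) d 0 := by
    have h : HasDerivAt (fun z : ℂ ↦ theta1 (Real.pi / 3 - z) τ) (-d) 0 :=
      .comp_const_sub (Real.pi / 3 : ℂ) 0 (by rwa [sub_zero])
    refine (h.fun_neg.congr_deriv (neg_neg d)).congr_of_eventuallyEq (.of_forall fun z ↦ ?_)
    beta_reduce
    rw [← theta1_neg, neg_sub]
  refine (((hadd.fun_pow 3).fun_add (hsub.fun_pow 3)).fun_sub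
    ((hasDerivAt_theta1 hτ 0).fun_pow 3)).congr_deriv ?_
  rw [zero_add, zero_sub, theta1_neg, theta1_zero]
  push_cast
  ring

lemma cubicThetaA_eq_aGR {τ : ℂ} (hτ : 0 < τ.im) : cubicThetaA τ = aGR τ := by
  have hL := hasDerivAt_theta_cube_zero hτ (hasDerivAt_theta1_pi_div_three hτ)
  rw [funext fun z ↦ theta_cube_eq_cubicThetaA hτ z, theta1_pi_div_three_sq hτ] at hL
  have h := hL.unique ((hasDerivAt_theta1_three_mul hτ).const_mul (3 * cubicThetaA τ))
  have hE := tprod_one_sub_pow_ne_zero (q := Complex.exp (2 * Real.pi * I * τ) ^ 3)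
    (norm_pow_succ_lt_one (norm_exp_two_pi_I_mul_lt_one hτ) 2)
  have he : Complex.exp (Real.pi * I * τ / 4) ≠ 0 := Complex.exp_ne_zero _
  generalize (∏' n : ℕ, (1 - (Complex.exp (2 * Real.pi * I * τ) ^ 3) ^ (n + 1))) = E at *
  generalize Complex.exp (Real.pi * I * τ / 4) = e at *
  have h0 : 18 * e ^ 3 * E ^ 3 ≠ 0 := by simp [he, hE]
  exact mul_left_cancel₀ h0 (by linear_combination -h)

theorem theta_cube_identity (τ : ℂ) (hτ : 0 < τ.im) (z : ℂ) :
    theta1 (z + Real.pi / 3) τ ^ 3 + theta1 (z - Real.pi / 3) τ ^ 3 -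
        theta1 z τ ^ 3 = 3 * aGR τ * theta1 (3 * z) (3 * τ) := by
  rw [theta_cube_eq_cubicThetaA hτ, cubicThetaA_eq_aGR hτ]
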